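/- arXiv:2107.04519 — 6 statements merged into one kernel-verified Lean document; each statement's English description precedes it below -/
import Mathlib

section
/- Let f : V → U be a morphism of persistence modules over ℝ, and let I, J be intervals of ℝ. If s ≤ t with s, t ∈ I ∩ J, then the structure map φ_{st} of U maps Y⁻_{IJ}[f](s) onto Y⁻_{IJ}[f](t), where Y⁻_{IJ}[f](t) := f(V⁻_{It}) + U⁻_{Jt}. -/
/-!
Basic notions for persistence modules indexed over `ℝ`, following
Crawley-Boevey's decomposition theory.  A persistence module is given by a
family of vector spaces `V t` together with structure maps
`ρ s t : V s →ₗ[k] V t` for `s ≤ t`.  An interval of `ℝ` (possibly with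
decorated endpoints) is encoded as an order-connected subset `I : Set ℝ`;
for `t ∈ I` the sets `{s | s ≤ t ∧ s ∈ I}`, `{s | s ≤ t ∧ s ∉ I}`,
`{r | t ≤ r ∧ r ∉ I}` and `{r | t ≤ r ∧ r ∈ I}` are exactly
`⟨a, t⁺⟩`, `⟨-∞, a⟩`, `⟨b, ∞⟩` and `⟨t⁻, b⟩` for `I = ⟨a, b⟩`.
-/

open scoped Classical

noncomputable section

variable (k : Type) [Field k]

section Defs

variable (V : ℝ → Type) [∀ t, AddCommGroup (V t)] [∀ t, Module k (V t)]
variable (ρ : ∀ s t : ℝ, s ≤ t → (V s →ₗ[k] V t))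

/-- `(V, ρ)` is a functor `ℝ → vect`: a persistence module. -/
def IsPersistenceModule : Prop :=
  (∀ t (x : V t), ρ t t le_rfl x = x) ∧
    ∀ s t u (hst : s ≤ t) (htu : t ≤ u) (x : V s),
      ρ t u htu (ρ s t hst x) = ρ s u (hst.trans htu) x

/-- Descending chain condition on images. -/
def DCCImages : Prop :=
  ∀ t : ℝ, ∀ s : ℕ → ℝ, ∀ h : ∀ n, s n ≤ t, Antitone s →
    ∃ N, ∀ n, N ≤ n →
      LinearMap.range (ρ (s n) t (h n)) = LinearMap.range (ρ (s N) t (h N))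

/-- Descending chain condition on kernels. -/
def DCCKernels : Prop :=
  ∀ t : ℝ, ∀ r : ℕ → ℝ, ∀ h : ∀ n, t ≤ r n, Monotone r →
    ∃ N, ∀ n, N ≤ n →
      LinearMap.ker (ρ t (r n) (h n)) = LinearMap.ker (ρ t (r N) (h N))

/-- `Im⁺_{at}(V) = ⋂_{s ∈ ⟨a,t⁺⟩} Im ρ_{st}`, for `I = ⟨a,b⟩` and `t ∈ I`. -/
def ImP (I : Set ℝ) (t : ℝ) : Submodule k (V t) :=
  ⨅ s : {s : ℝ // s ≤ t ∧ s ∈ I}, LinearMap.range (ρ s.1 t s.2.1)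

/-- `Im⁻_{at}(V) = ⋃_{s < a} Im ρ_{st}`, for `I = ⟨a,b⟩` and `t ∈ I`. -/
def ImM (I : Set ℝ) (t : ℝ) : Submodule k (V t) :=
  ⨆ s : {s : ℝ // s ≤ t ∧ s ∉ I}, LinearMap.range (ρ s.1 t s.2.1)

/-- `Ker⁺_{bt}(V) = ⋂_{r > b} Ker ρ_{tr}`, for `I = ⟨a,b⟩` and `t ∈ I`. -/
def KerP (I : Set ℝ) (t : ℝ) : Submodule k (V t) :=
  ⨅ r : {r : ℝ // t ≤ r ∧ r ∉ I}, LinearMap.ker (ρ t r.1 r.2.1)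

/-- `Ker⁻_{bt}(V) = ⋃_{t ≤ r < b} Ker ρ_{tr}`, for `I = ⟨a,b⟩` and `t ∈ I`. -/
def KerM (I : Set ℝ) (t : ℝ) : Submodule k (V t) :=
  ⨆ r : {r : ℝ // t ≤ r ∧ r ∈ I}, LinearMap.ker (ρ t r.1 r.2.1)

/-- `V⁺_{It}` (and `0` outside `I`). -/
def Vp (I : Set ℝ) (t : ℝ) : Submodule k (V t) :=
  if t ∈ I then ImP k V ρ I t ⊓ KerP k V ρ I t else ⊥

/-- `V⁻_{It}` (and `0` outside `I`). -/
def Vm (I : Set ℝ) (t : ℝ) : Submodule k (V t) :=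
  if t ∈ I then
    ImM k V ρ I t ⊓ KerP k V ρ I t ⊔ ImP k V ρ I t ⊓ KerM k V ρ I t
  else ⊥

/-- The quotient `V_{It} = V⁺_{It}/V⁻_{It}`. -/
def VIq (I : Set ℝ) (t : ℝ) : Type :=
  ↥(Vp k V ρ I t) ⧸ Submodule.comap (Vp k V ρ I t).subtype (Vm k V ρ I t)

instance (I : Set ℝ) (t : ℝ) : AddCommGroup (VIq k V ρ I t) := by
  unfold VIq; infer_instance

instance (I : Set ℝ) (t : ℝ) : Module k (VIq k V ρ I t) := by
  unfold VIq; infer_instance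

end Defs

section Mor

variable (V : ℝ → Type) [∀ t, AddCommGroup (V t)] [∀ t, Module k (V t)]
variable (ρ : ∀ s t : ℝ, s ≤ t → (V s →ₗ[k] V t))
variable (U : ℝ → Type) [∀ t, AddCommGroup (U t)] [∀ t, Module k (U t)]
variable (φ : ∀ s t : ℝ, s ≤ t → (U s →ₗ[k] U t))
variable (f : ∀ t, V t →ₗ[k] U t)

/-- `f` is a morphism of persistence modules (a natural transformation). -/
def IsPersistenceMorphism : Prop :=
  ∀ s t (h : s ≤ t) (x : V s), f t (ρ s t h x) = φ s t h (f s x)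

/-- `Y⁺_{IJ}[f](t) = f(V⁺_{It}) ∩ U⁺_{Jt}`. -/
def Yp (I J : Set ℝ) (t : ℝ) : Submodule k (U t) :=
  (Vp k V ρ I t).map (f t) ⊓ Vp k U φ J t

/-- `Y⁻_{IJ}[f](t) = f(V⁻_{It}) + U⁻_{Jt}`. -/
def Ym (I J : Set ℝ) (t : ℝ) : Submodule k (U t) :=
  (Vm k V ρ I t).map (f t) ⊔ Vm k U φ J t

/-- `X_{IJ}[f](t) = Y⁺_{IJ}[f](t) / (Y⁻_{IJ}[f](t) ∩ Y⁺_{IJ}[f](t))`. -/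
def Xq (I J : Set ℝ) (t : ℝ) : Type :=
  ↥(Yp k V ρ U φ f I J t) ⧸
    Submodule.comap (Yp k V ρ U φ f I J t).subtype (Ym k V ρ U φ f I J t)

instance (I J : Set ℝ) (t : ℝ) : AddCommGroup (Xq k V ρ U φ f I J t) := by
  unfold Xq; infer_instance

instance (I J : Set ℝ) (t : ℝ) : Module k (Xq k V ρ U φ f I J t) := by
  unfold Xq; infer_instance

/-- `upperClosure` of a set of reals: `⟨a, ∞⟩` for `I = ⟨a,b⟩`. -/
def upC (I : Set ℝ) : Set ℝ := {x | ∃ y ∈ I, y ≤ x}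

/-- `lowerClosure` of a set of reals: `⟨-∞, b⟩` for `I = ⟨a,b⟩`. -/
def lowC (I : Set ℝ) : Set ℝ := {x | ∃ y ∈ I, x ≤ y}

end Mor

section Transport

variable {k}
variable {V : ℝ → Type} [∀ t, AddCommGroup (V t)] [∀ t, Module k (V t)]
variable {ρ : ∀ s t : ℝ, s ≤ t → (V s →ₗ[k] V t)}

theorem IsPersistenceModule.comp_eq (hV : IsPersistenceModule k V ρ) {r s t : ℝ}
    (hrs : r ≤ s) (hst : s ≤ t) : ρ s t hst ∘ₗ ρ r s hrs = ρ r t (hrs.trans hst) :=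
  LinearMap.ext (hV.2 r s t hrs hst)

theorem IsPersistenceModule.range_mono (hV : IsPersistenceModule k V ρ) {r s t : ℝ}
    (hrs : r ≤ s) (hst : s ≤ t) :
    LinearMap.range (ρ r t (hrs.trans hst)) ≤ LinearMap.range (ρ s t hst) := by
  rw [← hV.comp_eq hrs hst]
  exact LinearMap.range_comp_le_range _ _

theorem IsPersistenceModule.ker_mono (hV : IsPersistenceModule k V ρ) {r s t : ℝ}
    (hrs : r ≤ s) (hst : s ≤ t) :
    LinearMap.ker (ρ r s hrs) ≤ LinearMap.ker (ρ r t (hrs.trans hst)) := by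
  rw [← hV.comp_eq hrs hst]
  exact LinearMap.ker_le_ker_comp _ _

theorem IsPersistenceModule.map_range (hV : IsPersistenceModule k V ρ) {r s t : ℝ}
    (hrs : r ≤ s) (hst : s ≤ t) :
    (LinearMap.range (ρ r s hrs)).map (ρ s t hst) =
      LinearMap.range (ρ r t (hrs.trans hst)) := by
  rw [← LinearMap.range_comp, hV.comp_eq]

theorem IsPersistenceModule.comap_ker (hV : IsPersistenceModule k V ρ) {r s t : ℝ}
    (hrs : r ≤ s) (hst : s ≤ t) :
    (LinearMap.ker (ρ s t hst)).comap (ρ r s hrs) =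
      LinearMap.ker (ρ r t (hrs.trans hst)) := by
  rw [← LinearMap.ker_comp, hV.comp_eq]

/-- Under the chain condition on images, the intersection defining `Im⁺` is attained. -/
theorem exists_ImP_eq_range (hV : IsPersistenceModule k V ρ) (hd : DCCImages k V ρ)
    {I : Set ℝ} {t : ℝ} (ht : t ∈ I) :
    ∃ (u : ℝ) (hu : u ≤ t), u ∈ I ∧ ImP k V ρ I t = LinearMap.range (ρ u t hu) := by
  suffices h : ∃ u : {u : ℝ // u ≤ t ∧ u ∈ I}, ∀ v : {u : ℝ // u ≤ t ∧ u ∈ I},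
      LinearMap.range (ρ u.1 t u.2.1) ≤ LinearMap.range (ρ v.1 t v.2.1) by
    obtain ⟨u, hu⟩ := h
    exact ⟨u.1, u.2.1, u.2.2, le_antisymm (iInf_le _ u) (le_iInf hu)⟩
  by_contra! h
  choose g hg using h
  have hlt : ∀ u, (g u).1 ≤ u.1 := fun u => by
    by_contra! hlt
    exact hg u (hV.range_mono hlt.le (g u).2.1)
  let c : ℕ → {u : ℝ // u ≤ t ∧ u ∈ I} := fun n => g^[n] ⟨t, le_rfl, ht⟩
  have hc : ∀ n, c (n + 1) = g (c n) := fun n => Function.iterate_succ_apply' g n _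
  obtain ⟨N, hN⟩ := hd t (fun n => (c n).1) (fun n => (c n).2.1)
    (antitone_nat_of_succ_le fun n => by rw [hc]; exact hlt _)
  have hN' : LinearMap.range (ρ (c (N + 1)).1 t (c (N + 1)).2.1) =
      LinearMap.range (ρ (c N).1 t (c N).2.1) := hN (N + 1) N.le_succ
  rw [hc] at hN'
  exact hg (c N) hN'.ge

theorem map_ImP (hV : IsPersistenceModule k V ρ) (hd : DCCImages k V ρ)
    {I : Set ℝ} {s t : ℝ} (hs : s ∈ I) (hst : s ≤ t) :
    (ImP k V ρ I s).map (ρ s t hst) = ImP k V ρ I t := by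
  obtain ⟨u, hu, huI, h⟩ := exists_ImP_eq_range hV hd hs
  rw [h, hV.map_range]
  refine le_antisymm (le_iInf fun v => ?_)
    (iInf_le _ (⟨u, hu.trans hst, huI⟩ : {u : ℝ // u ≤ t ∧ u ∈ I}))
  rcases le_total v.1 s with hv | hv
  · have hle : LinearMap.range (ρ u s hu) ≤ LinearMap.range (ρ v.1 s hv) :=
      h ▸ iInf_le _ (⟨v.1, hv, v.2.2⟩ : {v : ℝ // v ≤ s ∧ v ∈ I})
    rw [← hV.map_range hu hst, ← hV.map_range hv hst]
    exact Submodule.map_mono hle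
  · exact hV.range_mono (hu.trans hv) v.2.1

theorem map_ImM (hV : IsPersistenceModule k V ρ) {I : Set ℝ} (hI : I.OrdConnected)
    {s t : ℝ} (hs : s ∈ I) (ht : t ∈ I) (hst : s ≤ t) :
    (ImM k V ρ I s).map (ρ s t hst) = ImM k V ρ I t := by
  rw [ImM, Submodule.map_iSup]
  refine le_antisymm (iSup_le fun u => ?_) (iSup_le fun u => ?_)
  · rw [hV.map_range]
    exact le_iSup (fun u : {u : ℝ // u ≤ t ∧ u ∉ I} => LinearMap.range (ρ u.1 t u.2.1))
      ⟨u.1, u.2.1.trans hst, u.2.2⟩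
  · have hu : u.1 ≤ s := by
      by_contra! hlt
      exact u.2.2 (hI.out hs ht ⟨hlt.le, u.2.1⟩)
    rw [← hV.map_range hu hst]
    exact le_iSup (fun u : {u : ℝ // u ≤ s ∧ u ∉ I} =>
      (LinearMap.range (ρ u.1 s u.2.1)).map (ρ s t hst)) ⟨u.1, hu, u.2.2⟩

theorem comap_KerP (hV : IsPersistenceModule k V ρ) {I : Set ℝ} (hI : I.OrdConnected)
    {s t : ℝ} (hs : s ∈ I) (ht : t ∈ I) (hst : s ≤ t) :
    (KerP k V ρ I t).comap (ρ s t hst) = KerP k V ρ I s := by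
  rw [KerP, Submodule.comap_iInf]
  refine le_antisymm (le_iInf fun r => ?_) (le_iInf fun r => ?_)
  · have hr : t ≤ r.1 := by
      by_contra! hlt
      exact r.2.2 (hI.out hs ht ⟨r.2.1, hlt.le⟩)
    rw [← hV.comap_ker hst hr]
    exact iInf_le (fun r : {r : ℝ // t ≤ r ∧ r ∉ I} =>
      (LinearMap.ker (ρ t r.1 r.2.1)).comap (ρ s t hst)) ⟨r.1, hr, r.2.2⟩
  · rw [hV.comap_ker]
    exact iInf_le _ (⟨r.1, hst.trans r.2.1, r.2.2⟩ : {r : ℝ // s ≤ r ∧ r ∉ I})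

theorem mem_KerM (hV : IsPersistenceModule k V ρ) {I : Set ℝ} {t : ℝ} (ht : t ∈ I)
    {x : V t} : x ∈ KerM k V ρ I t ↔ ∃ (r : ℝ) (hr : t ≤ r), r ∈ I ∧ ρ t r hr x = 0 := by
  have : Nonempty {r : ℝ // t ≤ r ∧ r ∈ I} := ⟨⟨t, le_rfl, ht⟩⟩
  have hmono : Monotone fun r : {r : ℝ // t ≤ r ∧ r ∈ I} => LinearMap.ker (ρ t r.1 r.2.1) :=
    fun r r' h => hV.ker_mono r.2.1 h
  rw [KerM, Submodule.mem_iSup_of_directed _ hmono.directed_le]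
  exact ⟨fun ⟨r, h⟩ => ⟨r.1, r.2.1, r.2.2, h⟩, fun ⟨r, hr, hrI, h⟩ => ⟨⟨r, hr, hrI⟩, h⟩⟩

theorem comap_KerM (hV : IsPersistenceModule k V ρ) {I : Set ℝ}
    {s t : ℝ} (hs : s ∈ I) (ht : t ∈ I) (hst : s ≤ t) :
    (KerM k V ρ I t).comap (ρ s t hst) = KerM k V ρ I s := by
  ext x
  rw [Submodule.mem_comap, mem_KerM hV ht, mem_KerM hV hs]
  constructor
  · rintro ⟨r, hr, hrI, h⟩
    exact ⟨r, hst.trans hr, hrI, by rwa [← hV.2 s t r hst hr]⟩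
  · rintro ⟨r, hr, hrI, h⟩
    rcases le_total r t with hrt | htr
    · exact ⟨t, le_rfl, ht, by rw [hV.1, ← hV.2 s r t hr hrt, h, map_zero]⟩
    · exact ⟨r, htr, hrI, by rwa [hV.2]⟩

theorem Submodule.map_inf_comap_eq {M N : Type*} [AddCommGroup M] [Module k M]
    [AddCommGroup N] [Module k N] (g : M →ₗ[k] N) (A : Submodule k M) (B : Submodule k N) :
    (A ⊓ B.comap g).map g = A.map g ⊓ B :=
  SetLike.coe_injective (Set.image_inter_preimage g A B)

theorem map_Vm (hV : IsPersistenceModule k V ρ) (hd : DCCImages k V ρ)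
    {I : Set ℝ} (hI : I.OrdConnected) {s t : ℝ} (hs : s ∈ I) (ht : t ∈ I) (hst : s ≤ t) :
    (Vm k V ρ I s).map (ρ s t hst) = Vm k V ρ I t := by
  rw [Vm, Vm, if_pos hs, if_pos ht, Submodule.map_sup, ← comap_KerP hV hI hs ht hst,
    ← comap_KerM hV hs ht hst, Submodule.map_inf_comap_eq, Submodule.map_inf_comap_eq,
    map_ImM hV hI hs ht, map_ImP hV hd hs]

end Transport

/-- for a morphism `f : V → U` of persistence modules over `ℝ` and
intervals `I, J`, if `s ≤ t` with `s, t ∈ I ∩ J`, then the structure map `φ_{st}` of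
`U` maps `Y⁻_{IJ}[f](s)` onto `Y⁻_{IJ}[f](t)`. -/
theorem stmt_7
    (V : ℝ → Type) [∀ t, AddCommGroup (V t)] [∀ t, Module k (V t)]
    (ρ : ∀ s t : ℝ, s ≤ t → (V s →ₗ[k] V t))
    (U : ℝ → Type) [∀ t, AddCommGroup (U t)] [∀ t, Module k (U t)]
    (φ : ∀ s t : ℝ, s ≤ t → (U s →ₗ[k] U t))
    (hV : IsPersistenceModule k V ρ) (hU : IsPersistenceModule k U φ)
    (hVdcci : DCCImages k V ρ) (hVdcck : DCCKernels k V ρ)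
    (hUdcci : DCCImages k U φ) (hUdcck : DCCKernels k U φ)
    (f : ∀ t, V t →ₗ[k] U t)
    (hf : IsPersistenceMorphism k V ρ U φ f)
    (I J : Set ℝ) (hI : I.OrdConnected) (hJ : J.OrdConnected)
    (s t : ℝ) (hs : s ∈ I ∩ J) (ht : t ∈ I ∩ J) (hst : s ≤ t) :
    (Ym k V ρ U φ f I J s).map (φ s t hst) = Ym k V ρ U φ f I J t := by
  have hcomm : φ s t hst ∘ₗ f s = f t ∘ₗ ρ s t hst :=
    LinearMap.ext fun x => (hf s t hst x).symm
  rw [Ym, Ym, Submodule.map_sup, ← Submodule.map_comp, hcomm, Submodule.map_comp,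
    map_Vm hV hVdcci hI hs.1 ht.1, map_Vm hU hUdcci hJ hs.2 ht.2]
end
end

section
/- Let V be a persistence module over ℝ with a persistence basis β : ⊕_{i∈I} k_{⟨a_i,b_i⟩} → V (an isomorphism). Suppose V(t) = 0 for all t > b (in decorated endpoint order). Then for any λ < b, the dimension of colim_{t ∈ ⟨λ,b⟩} V(t) equals the number of basis generators β_i whose interval has right endpoint exactly b. -/
/-!
Basic notions for persistence modules indexed over `ℝ`, following
Crawley-Boevey's decomposition theory.  A persistence module is given by a
family of vector spaces `V t` together with structure maps
`ρ s t : V s →ₗ[k] V t` for `s ≤ t`.  An interval of `ℝ` (possibly with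
decorated endpoints) is encoded as an order-connected subset `I : Set ℝ`;
for `t ∈ I` the sets `{s | s ≤ t ∧ s ∈ I}`, `{s | s ≤ t ∧ s ∉ I}`,
`{r | t ≤ r ∧ r ∉ I}` and `{r | t ≤ r ∧ r ∈ I}` are exactly
`⟨a, t⁺⟩`, `⟨-∞, a⟩`, `⟨b, ∞⟩` and `⟨t⁻, b⟩` for `I = ⟨a, b⟩`.
-/

open scoped Classical

noncomputable section

variable (k : Type) [Field k]

theorem exists_mem_inter_of_lowC_eq {I K : Set ℝ} (hK : K.OrdConnected) (hKne : K.Nonempty)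
    (h : lowC I = lowC K) : ∃ t ∈ K, t ∈ I := by
  obtain ⟨y, hy⟩ := hKne
  have hyI : y ∈ lowC I := h ▸ ⟨y, hy, le_rfl⟩
  obtain ⟨z, hz, hyz⟩ := hyI
  have hzK : z ∈ lowC K := h ▸ ⟨z, hz, le_rfl⟩
  obtain ⟨y', hy', hzy'⟩ := hzK
  exact ⟨z, hK.out hy hy' ⟨hyz, hzy'⟩, hz⟩

theorem mem_of_lowC_eq {I K : Set ℝ} (hI : I.OrdConnected) (h : lowC I = lowC K)
    {p q : ℝ} (hp : p ∈ I) (hpq : p ≤ q) (hq : q ∈ K) : q ∈ I := by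
  have hqI : q ∈ lowC I := h ▸ ⟨q, hq, le_rfl⟩
  obtain ⟨y, hy, hqy⟩ := hqI
  exact hI.out hp hy ⟨hpq, hqy⟩

theorem lowC_eq_of_forall_mem {I K : Set ℝ} {p : ℝ} (hp : p ∈ K)
    (hpI : ∀ s ∈ K, p ≤ s → s ∈ I) (hI : ∀ t ∈ I, t ∉ K → ∀ y ∈ K, ¬ y ≤ t) :
    lowC I = lowC K := by
  ext x
  constructor
  · rintro ⟨z, hz, hxz⟩
    by_cases hzK : z ∈ K
    · exact ⟨z, hzK, hxz⟩
    · exact ⟨p, hp, hxz.trans (not_le.1 (hI z hz hzK p hp)).le⟩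
  · rintro ⟨y, hy, hxy⟩
    rcases le_total p y with h | h
    · exact ⟨y, hpI y hy h, hxy⟩
    · exact ⟨p, hpI p hp le_rfl, hxy.trans h⟩

/-- if `V` has a persistence basis `β : ⊕ᵢ k_{⟨aᵢ,bᵢ⟩} ≃ V` (encoded by the
generator vectors `v i t`) and `V(t) = 0` for all `t` beyond the right endpoint `b` of
the interval `K = ⟨λ,b⟩`, then `dim colim_{t ∈ K} V(t)` is the number of generators
whose interval has right endpoint exactly `b` (i.e. the same lower closure as `K`). -/
theorem stmt_9
    (V : ℝ → Type) [∀ t, AddCommGroup (V t)] [∀ t, Module k (V t)]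
    (ρ : ∀ s t : ℝ, s ≤ t → (V s →ₗ[k] V t))
    (hV : IsPersistenceModule k V ρ)
    {ι : Type} (Iv : ι → Set ℝ) (hIv : ∀ i, (Iv i).OrdConnected)
    (hIvne : ∀ i, (Iv i).Nonempty)
    -- `v i t` is the image in `V t` of the canonical generator of the `i`-th interval
    -- module; together they form a persistence basis of `V`.
    (v : ∀ (_ : ι) (t : ℝ), V t)
    (hsupp : ∀ i t, t ∉ Iv i → v i t = 0)
    (hnz : ∀ i t, t ∈ Iv i → v i t ≠ 0)
    (hnat : ∀ i s t (h : s ≤ t), s ∈ Iv i → ρ s t h (v i s) = v i t)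
    (hindep : ∀ t : ℝ, LinearIndependent k (fun i : {i // t ∈ Iv i} => v i.1 t))
    (hspan : ∀ t : ℝ,
      ⊤ ≤ Submodule.span k (Set.range fun i : {i // t ∈ Iv i} => v i.1 t))
    (K : Set ℝ) (hK : K.OrdConnected) (hKne : K.Nonempty)
    -- `V (t) = 0` for every `t` strictly beyond the right endpoint of `K`
    (hzero : ∀ t : ℝ, t ∉ K → (∃ y ∈ K, y ≤ t) → Subsingleton (V t)) :
    Module.rank k
        (Module.DirectLimit (fun p : K => V p.1) (fun p q h => ρ p.1 q.1 h)) =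
      Cardinal.mk {i : ι // lowC (Iv i) = lowC K} := by
  have : Nonempty K := hKne.to_subtype
  have hpers : ∀ i, ∀ p ∈ K, (∀ s ∈ K, p ≤ s → s ∈ Iv i) → lowC (Iv i) = lowC K := by
    intro i p hp hpI
    refine lowC_eq_of_forall_mem hp hpI fun t ht htK y hy hyt => hnz i t ht ?_
    have := hzero t htK ⟨y, hy, hyt⟩
    exact Subsingleton.elim _ _
  choose τ hτK hτI using fun j : {i : ι // lowC (Iv i) = lowC K} =>
    exists_mem_inter_of_lowC_eq hK hKne j.2
  let D := Module.DirectLimit (fun p : K => V p.1) (fun p q h => ρ p.1 q.1 h)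
  let o : ∀ p : K, V p.1 →ₗ[k] D := fun p =>
    Module.DirectLimit.of k K (fun p : K => V p.1) (fun p q h => ρ p.1 q.1 h) p
  have ho : ∀ (i : ι) (p q : K), p ≤ q → p.1 ∈ Iv i → o p (v i p) = o q (v i q) := by
    intro i p q hpq hp
    rw [← hnat i p.1 q.1 hpq hp]
    exact (Module.DirectLimit.of_f (G := fun p : K => V p.1)
      (f := fun p q h => ρ p.1 q.1 h) (hij := hpq)).symm
  have ho' : ∀ (i : ι) (p q : K), p.1 ∈ Iv i → q.1 ∈ Iv i → o p (v i p) = o q (v i q) := by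
    intro i p q hp hq
    rcases le_total p q with h | h
    · exact ho i p q h hp
    · exact (ho i q p h hq).symm
  let w : {i : ι // lowC (Iv i) = lowC K} → D := fun j => o ⟨τ j, hτK j⟩ (v j.1 (τ j))
  let g : ι → ({i : ι // lowC (Iv i) = lowC K} →₀ k) := fun i =>
    if h : lowC (Iv i) = lowC K then Finsupp.single ⟨i, h⟩ 1 else 0
  let B := fun t : ℝ => Module.Basis.mk (hindep t) (hspan t)
  let L : ∀ p : K, V p.1 →ₗ[k] ({i : ι // lowC (Iv i) = lowC K} →₀ k) := fun p =>
    (B p.1).constr k fun i => g i.1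
  have hL : ∀ (p : K) (i : ι), p.1 ∈ Iv i → L p (v i p) = g i := by
    intro p i hi
    have := (B p.1).constr_basis k (fun i => g i.1) ⟨i, hi⟩
    rwa [Module.Basis.mk_apply] at this
  have hLρ : ∀ (p q : K) (h : p ≤ q) (x : V p.1), L q (ρ p.1 q.1 h x) = L p x := by
    intro p q h x
    suffices L q ∘ₗ ρ p.1 q.1 h = L p from LinearMap.congr_fun this x
    refine (B p.1).ext fun i => ?_
    rw [Module.Basis.mk_apply, LinearMap.comp_apply, hnat i.1 p.1 q.1 h i.2, hL p i.1 i.2]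
    by_cases hq : q.1 ∈ Iv i.1
    · exact hL q i.1 hq
    · have hi : lowC (Iv i.1) ≠ lowC K := fun hi =>
        hq (mem_of_lowC_eq (hIv i.1) hi i.2 h q.2)
      rw [hsupp i.1 q.1 hq, map_zero]
      simp only [g, dif_neg hi]
  let Λ : D →ₗ[k] ({i : ι // lowC (Iv i) = lowC K} →₀ k) :=
    Module.DirectLimit.lift k K (fun p : K => V p.1) (fun p q h => ρ p.1 q.1 h) L hLρ
  have hΛ : ∀ j, Λ (w j) = Finsupp.single j 1 := by
    intro j
    have h : Λ (w j) = L ⟨τ j, hτK j⟩ (v j.1 (τ j)) := Module.DirectLimit.lift_of ..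
    rw [h]
    exact (hL ⟨τ j, hτK j⟩ j.1 (hτI j)).trans (dif_pos j.2)
  have hw : LinearIndependent k w := by
    refine LinearIndependent.of_comp Λ ?_
    have : Λ ∘ w = fun j => Finsupp.single j (1 : k) := funext hΛ
    rw [this]
    exact Finsupp.linearIndependent_single_one k _
  have hwspan : ⊤ ≤ Submodule.span k (Set.range w) := by
    rintro x -
    obtain ⟨p, y, rfl⟩ : ∃ p y, o p y = x := Module.DirectLimit.exists_of x
    have hy : y ∈ (Submodule.span k (Set.range w)).comap (o p) := by
      refine (Submodule.span_le.2 ?_) (hspan p.1 (Submodule.mem_top (x := y)))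
      rintro _ ⟨⟨i, hi⟩, rfl⟩
      change o p (v i p) ∈ Submodule.span k (Set.range w)
      by_cases hiK : lowC (Iv i) = lowC K
      · rw [ho' i p ⟨τ ⟨i, hiK⟩, hτK _⟩ hi (hτI ⟨i, hiK⟩)]
        exact Submodule.subset_span ⟨⟨i, hiK⟩, rfl⟩
      · obtain ⟨s, hs, hps, hsI⟩ : ∃ s ∈ K, p.1 ≤ s ∧ s ∉ Iv i := by
          by_contra! hcon
          exact hiK (hpers i p.1 p.2 hcon)
        rw [ho i p ⟨s, hs⟩ hps hi, hsupp i s hsI, map_zero]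
        exact Submodule.zero_mem _
    exact hy
  exact (Module.Basis.mk hw hwspan).mk_eq_rank''.symm
end
end

section
/- Let V be a persistence module over ℝ with persistence basis β, let c be a decorated endpoint, and let t ∈ ⟨c, ∞⟩. Then dim Im⁺_{ct}(V) equals the number of generators β_i ∼ ⟨a,b⟩ with a ≤ c and t ∈ ⟨a,b⟩, and dim Im⁻_{ct}(V) equals the number of generators β_i ∼ ⟨a,b⟩ with a < c and t ∈ ⟨a,b⟩. -/
/-!
Basic notions for persistence modules indexed over `ℝ`, following
Crawley-Boevey's decomposition theory.  A persistence module is given by a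
family of vector spaces `V t` together with structure maps
`ρ s t : V s →ₗ[k] V t` for `s ≤ t`.  An interval of `ℝ` (possibly with
decorated endpoints) is encoded as an order-connected subset `I : Set ℝ`;
for `t ∈ I` the sets `{s | s ≤ t ∧ s ∈ I}`, `{s | s ≤ t ∧ s ∉ I}`,
`{r | t ≤ r ∧ r ∉ I}` and `{r | t ≤ r ∧ r ∈ I}` are exactly
`⟨a, t⁺⟩`, `⟨-∞, a⟩`, `⟨b, ∞⟩` and `⟨t⁻, b⟩` for `I = ⟨a, b⟩`.
-/

open scoped Classical

noncomputable section

variable (k : Type) [Field k]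

section GeneratingFamily

variable {k}
variable {V : ℝ → Type} [∀ t, AddCommGroup (V t)] [∀ t, Module k (V t)]

/-- The image of a structure map is spanned by the generators alive at both ends. -/
lemma range_structureMap_eq_span (ρ : ∀ s t : ℝ, s ≤ t → (V s →ₗ[k] V t))
    {ι : Type} (Iv : ι → Set ℝ) (v : ∀ (_ : ι) (t : ℝ), V t)
    (hsupp : ∀ i t, t ∉ Iv i → v i t = 0)
    (hnat : ∀ i s t (h : s ≤ t), s ∈ Iv i → ρ s t h (v i s) = v i t)
    (hspan : ∀ t : ℝ,
      ⊤ ≤ Submodule.span k (Set.range fun i : {i // t ∈ Iv i} => v i.1 t))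
    (s t : ℝ) (h : s ≤ t) :
    LinearMap.range (ρ s t h) =
      Submodule.span k ((fun i : {i // t ∈ Iv i} => v i.1 t) '' {i | s ∈ Iv i.1}) := by
  rw [LinearMap.range_eq_map, ← top_le_iff.mp (hspan s), Submodule.map_span]
  apply le_antisymm
  · rw [Submodule.span_le]
    rintro _ ⟨_, ⟨⟨i, hi⟩, rfl⟩, rfl⟩
    simp only [hnat i s t h hi]
    by_cases hit : t ∈ Iv i
    · exact Submodule.subset_span ⟨⟨i, hit⟩, hi, rfl⟩
    · rw [hsupp i t hit]
      exact Submodule.zero_mem _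
  · apply Submodule.span_mono
    rintro _ ⟨⟨i, hit⟩, hi, rfl⟩
    exact ⟨v i s, ⟨⟨i, hi⟩, rfl⟩, hnat i s t h hi⟩

end GeneratingFamily

/-- Subspaces spanned by parts of a fixed basis intersect in the span of the common part. -/
lemma Module.Basis.iInf_span_image {k M J S : Type*} [Field k] [AddCommGroup M] [Module k M]
    (b : Module.Basis J k M) (A : S → Set J) :
    ⨅ s, Submodule.span k (b '' A s) = Submodule.span k (b '' ⋂ s, A s) := by
  ext m
  simp only [Submodule.mem_iInf, Module.Basis.mem_span_image, Set.subset_iInter_iff]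

/-- The span of part of a basis has rank the cardinality of that part. -/
lemma Module.Basis.rank_span_image {k J M : Type} [Field k] [AddCommGroup M] [Module k M]
    (b : Module.Basis J k M) (A : Set J) :
    Module.rank k (Submodule.span k (b '' A)) = Cardinal.mk A := by
  rw [rank_span_set (b.linearIndependent.linearIndepOn A).id_image,
    Cardinal.mk_image_eq b.injective]

lemma forall_mem_iff_subset_upC {I U : Set ℝ} (hI : I.OrdConnected)
    {t : ℝ} (htU : t ∈ U) (htI : t ∈ I) :
    (∀ s, s ≤ t → s ∈ U → s ∈ I) ↔ U ⊆ upC I := by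
  constructor
  · intro h x hx
    refine ⟨min x t, h _ (min_le_right _ _) ?_, min_le_left _ _⟩
    rcases min_choice x t with e | e <;> rwa [e]
  · intro h s hst hs
    obtain ⟨y, hy, hys⟩ := h hs
    exact hI.out hy htI ⟨hys, hst⟩

lemma exists_mem_iff_ssubset_upC {I U : Set ℝ} (hU : IsUpperSet U) {t : ℝ} (htU : t ∈ U) :
    (∃ s, s ≤ t ∧ s ∉ U ∧ s ∈ I) ↔ U ⊂ upC I := by
  constructor
  · rintro ⟨s, -, hsU, hsI⟩
    refine ⟨fun x hx => ⟨s, hsI, ?_⟩, fun h => hsU (h ⟨s, hsI, le_rfl⟩)⟩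
    by_contra! hxs
    exact hsU (hU hxs.le hx)
  · intro h
    obtain ⟨x, ⟨y, hy, hyx⟩, hx⟩ := Set.exists_of_ssubset h
    have hyU : y ∉ U := fun h' => hx (hU hyx h')
    refine ⟨y, ?_, hyU, hy⟩
    by_contra! hty
    exact hyU (hU hty.le htU)

/-- Reorder a subset of a subtype into a subtype cut out by a conjunction. -/
lemma Cardinal.mk_setOf_subtype {ι : Type} (p q : ι → Prop) :
    Cardinal.mk {i : {i // p i} | q i.1} = Cardinal.mk {i // q i ∧ p i} :=
  Cardinal.mk_congr <| (Equiv.subtypeSubtypeEquivSubtypeInter p q).trans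
    (Equiv.subtypeEquivRight fun _ => and_comm)

/-- for a persistence module `V` over `ℝ` with persistence basis
(encoded by generator vectors `v i t` supported on intervals `Iv i`), a decorated
endpoint `c` (encoded by the upper set `Uc = ⟨c,∞⟩`) and `t ∈ ⟨c,∞⟩`:
`dim Im⁺_{ct}(V) = #{i | aᵢ ≤ c ∧ t ∈ ⟨aᵢ,bᵢ⟩}` and
`dim Im⁻_{ct}(V) = #{i | aᵢ < c ∧ t ∈ ⟨aᵢ,bᵢ⟩}`.
Note that `aᵢ ≤ c` is `Uc ⊆ upC (Iv i)` and `aᵢ < c` is `Uc ⊂ upC (Iv i)`. -/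
theorem stmt_10
    (V : ℝ → Type) [∀ t, AddCommGroup (V t)] [∀ t, Module k (V t)]
    (ρ : ∀ s t : ℝ, s ≤ t → (V s →ₗ[k] V t))
    (hV : IsPersistenceModule k V ρ)
    {ι : Type} (Iv : ι → Set ℝ) (hIv : ∀ i, (Iv i).OrdConnected)
    (hIvne : ∀ i, (Iv i).Nonempty)
    (v : ∀ (_ : ι) (t : ℝ), V t)
    (hsupp : ∀ i t, t ∉ Iv i → v i t = 0)
    (hnz : ∀ i t, t ∈ Iv i → v i t ≠ 0)
    (hnat : ∀ i s t (h : s ≤ t), s ∈ Iv i → ρ s t h (v i s) = v i t)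
    (hindep : ∀ t : ℝ, LinearIndependent k (fun i : {i // t ∈ Iv i} => v i.1 t))
    (hspan : ∀ t : ℝ,
      ⊤ ≤ Submodule.span k (Set.range fun i : {i // t ∈ Iv i} => v i.1 t))
    (Uc : Set ℝ) (hUc : IsUpperSet Uc) (t : ℝ) (ht : t ∈ Uc) :
    Module.rank k ↥(ImP k V ρ Uc t) =
      Cardinal.mk {i : ι // Uc ⊆ upC (Iv i) ∧ t ∈ Iv i} ∧
    Module.rank k ↥(ImM k V ρ Uc t) =
      Cardinal.mk {i : ι // Uc ⊂ upC (Iv i) ∧ t ∈ Iv i} := by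
  let b : Module.Basis {i // t ∈ Iv i} k (V t) := Module.Basis.mk (hindep t) (hspan t)
  have hrange : ∀ s (h : s ≤ t),
      LinearMap.range (ρ s t h) = Submodule.span k (b '' {i | s ∈ Iv i.1}) := by
    intro s h
    rw [range_structureMap_eq_span ρ Iv v hsupp hnat hspan s t h, Module.Basis.coe_mk]
  constructor
  · have hset : ⋂ s : {s : ℝ // s ≤ t ∧ s ∈ Uc}, {i : {i // t ∈ Iv i} | s.1 ∈ Iv i.1} =
        {i | Uc ⊆ upC (Iv i.1)} := by
      ext i
      simp only [Set.mem_iInter, Set.mem_ofPred_eq, Subtype.forall, and_imp]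
      exact forall_mem_iff_subset_upC (hIv i.1) ht i.2
    have hIm : ImP k V ρ Uc t = Submodule.span k (b '' {i | Uc ⊆ upC (Iv i.1)}) := by
      simp only [ImP, hrange]
      rw [b.iInf_span_image, hset]
    rw [hIm, b.rank_span_image]
    exact Cardinal.mk_setOf_subtype _ fun i => Uc ⊆ upC (Iv i)
  · have hset : ⋃ s : {s : ℝ // s ≤ t ∧ s ∉ Uc}, {i : {i // t ∈ Iv i} | s.1 ∈ Iv i.1} =
        {i | Uc ⊂ upC (Iv i.1)} := by
      ext i
      simp only [Set.mem_iUnion, Set.mem_ofPred_eq, Subtype.exists, exists_prop, and_assoc]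
      exact exists_mem_iff_ssubset_upC hUc ht
    have hIm : ImM k V ρ Uc t = Submodule.span k (b '' {i | Uc ⊂ upC (Iv i.1)}) := by
      simp only [ImM, hrange]
      rw [← Submodule.span_iUnion, ← Set.image_iUnion, hset]
    rw [hIm, b.rank_span_image]
    exact Cardinal.mk_setOf_subtype _ fun i => Uc ⊂ upC (Iv i)
end
end

section
/- Let V be a persistence module over ℝ with persistence basis β, let c be a decorated endpoint, and let t ∈ ⟨−∞, c⟩. Then dim Ker⁺_{ct}(V) equals the number of generators β_i ∼ ⟨a,b⟩ with b ≤ c and t ∈ ⟨a,b⟩, and dim Ker⁻_{ct}(V) equals the number of generators β_i ∼ ⟨a,b⟩ with b < c and t ∈ ⟨a,b⟩. -/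
/-!
Basic notions for persistence modules indexed over `ℝ`, following
Crawley-Boevey's decomposition theory.  A persistence module is given by a
family of vector spaces `V t` together with structure maps
`ρ s t : V s →ₗ[k] V t` for `s ≤ t`.  An interval of `ℝ` (possibly with
decorated endpoints) is encoded as an order-connected subset `I : Set ℝ`;
for `t ∈ I` the sets `{s | s ≤ t ∧ s ∈ I}`, `{s | s ≤ t ∧ s ∉ I}`,
`{r | t ≤ r ∧ r ∉ I}` and `{r | t ≤ r ∧ r ∈ I}` are exactly
`⟨a, t⁺⟩`, `⟨-∞, a⟩`, `⟨b, ∞⟩` and `⟨t⁻, b⟩` for `I = ⟨a, b⟩`.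
-/

open scoped Classical

noncomputable section

variable (k : Type) [Field k]

section Helpers

/-- If `f` sends each vector of the basis `b` indexed outside `S` to a distinct vector of the basis
`c`, and kills those indexed by `S`, then its kernel is spanned by the latter. -/
lemma ker_eq_span_image_of_basis {k M N α γ : Type*} [Field k] [AddCommGroup M] [Module k M]
    [AddCommGroup N] [Module k N] (b : Module.Basis α k M) (c : Module.Basis γ k N) (f : M →ₗ[k] N)
    (S : Set α) (e : ∀ i, i ∉ S → γ) (he : ∀ i hi j hj, e i hi = e j hj → i = j)
    (hS : ∀ i ∈ S, f (b i) = 0) (hSc : ∀ i hi, f (b i) = c (e i hi)) :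
    LinearMap.ker f = Submodule.span k (b '' S) := by
  apply le_antisymm
  · intro x hx
    rw [b.mem_span_image]
    intro i hi
    by_contra hiS
    have hcoord : c.coord (e i hiS) ∘ₗ f = b.coord i := by
      refine b.ext fun j => ?_
      by_cases hj : j ∈ S
      · have hij : j ≠ i := fun h => hiS (h ▸ hj)
        simp [hS j hj, Finsupp.single_eq_of_ne' hij]
      · by_cases hij : j = i
        · subst hij
          simp [hSc j hj]
        · have hne : e j hj ≠ e i hiS := fun h => hij (he _ _ _ _ h)
          simp [hSc j hj, Finsupp.single_eq_of_ne' hij, Finsupp.single_eq_of_ne' hne]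
    have hzero : b.repr x i = 0 := by
      have := LinearMap.congr_fun hcoord x
      simpa [LinearMap.mem_ker.1 hx] using this.symm
    exact Finsupp.mem_support_iff.1 hi hzero
  · rw [Submodule.span_le]
    rintro _ ⟨i, hi, rfl⟩
    exact hS i hi

lemma iInf_span_image_of_basis {k M α κ : Type*} [Field k] [AddCommGroup M] [Module k M]
    (b : Module.Basis α k M) (S : κ → Set α) :
    ⨅ r, Submodule.span k (b '' S r) = Submodule.span k (b '' ⋂ r, S r) := by
  ext x
  simp only [Submodule.mem_iInf, b.mem_span_image, Set.subset_iInter_iff]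

lemma iSup_span_image {k M α κ : Type*} [Field k] [AddCommGroup M] [Module k M]
    (b : α → M) (S : κ → Set α) :
    ⨆ r, Submodule.span k (b '' S r) = Submodule.span k (b '' ⋃ r, S r) := by
  rw [Set.image_iUnion, Submodule.span_iUnion]

lemma rank_span_image_of_basis {k M α : Type} [Field k] [AddCommGroup M] [Module k M]
    (b : Module.Basis α k M) (S : Set α) :
    Module.rank k (Submodule.span k (b '' S)) = Cardinal.mk S := by
  rw [rank_span_set (b.linearIndependent.linearIndepOn S).id_image,
    Cardinal.mk_image_eq b.injective]

lemma lowC_subset_iff {I L : Set ℝ} (hL : IsLowerSet L) : lowC I ⊆ L ↔ I ⊆ L :=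
  ⟨fun h x hx => h ⟨x, hx, le_rfl⟩, fun h _ ⟨_, hy, hxy⟩ => hL hxy (h hy)⟩

lemma lowC_ssubset_iff {I L : Set ℝ} (hI : I.OrdConnected) (hL : IsLowerSet L) {t : ℝ}
    (ht : t ∈ I) : lowC I ⊂ L ↔ ∃ r, t ≤ r ∧ r ∈ L ∧ r ∉ I := by
  constructor
  · intro h
    obtain ⟨r, hrL, hr⟩ := Set.exists_of_ssubset h
    refine ⟨r, ?_, hrL, fun hrI => hr ⟨r, hrI, le_rfl⟩⟩
    by_contra! hrt
    exact hr ⟨t, ht, hrt.le⟩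
  · rintro ⟨r, htr, hrL, hrI⟩
    have hr : r ∉ lowC I := fun ⟨y, hy, hry⟩ => hrI (hI.out ht hy ⟨htr, hry⟩)
    refine ⟨fun x ⟨y, hy, hxy⟩ => hL ?_ hrL, fun h => hr (h hrL)⟩
    by_contra! hrx
    exact hr ⟨y, hy, hrx.le.trans hxy⟩

end Helpers

/-- for a persistence module `V` over `ℝ` with persistence basis
(encoded by generator vectors `v i t` supported on intervals `Iv i`), a decorated
endpoint `c` (encoded by the lower set `Lc = ⟨-∞,c⟩`) and `t ∈ ⟨-∞,c⟩`:
`dim Ker⁺_{ct}(V) = #{i | bᵢ ≤ c ∧ t ∈ ⟨aᵢ,bᵢ⟩}` and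
`dim Ker⁻_{ct}(V) = #{i | bᵢ < c ∧ t ∈ ⟨aᵢ,bᵢ⟩}`.
Note that `bᵢ ≤ c` is `lowC (Iv i) ⊆ Lc` and `bᵢ < c` is `lowC (Iv i) ⊂ Lc`. -/
theorem stmt_11
    (V : ℝ → Type) [∀ t, AddCommGroup (V t)] [∀ t, Module k (V t)]
    (ρ : ∀ s t : ℝ, s ≤ t → (V s →ₗ[k] V t))
    (hV : IsPersistenceModule k V ρ)
    {ι : Type} (Iv : ι → Set ℝ) (hIv : ∀ i, (Iv i).OrdConnected)
    (hIvne : ∀ i, (Iv i).Nonempty)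
    (v : ∀ (_ : ι) (t : ℝ), V t)
    (hsupp : ∀ i t, t ∉ Iv i → v i t = 0)
    (hnz : ∀ i t, t ∈ Iv i → v i t ≠ 0)
    (hnat : ∀ i s t (h : s ≤ t), s ∈ Iv i → ρ s t h (v i s) = v i t)
    (hindep : ∀ t : ℝ, LinearIndependent k (fun i : {i // t ∈ Iv i} => v i.1 t))
    (hspan : ∀ t : ℝ,
      ⊤ ≤ Submodule.span k (Set.range fun i : {i // t ∈ Iv i} => v i.1 t))
    (Lc : Set ℝ) (hLc : IsLowerSet Lc) (t : ℝ) (ht : t ∈ Lc) :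
    Module.rank k ↥(KerP k V ρ Lc t) =
      Cardinal.mk {i : ι // lowC (Iv i) ⊆ Lc ∧ t ∈ Iv i} ∧
    Module.rank k ↥(KerM k V ρ Lc t) =
      Cardinal.mk {i : ι // lowC (Iv i) ⊂ Lc ∧ t ∈ Iv i} := by
  let b (s : ℝ) : Module.Basis {i // s ∈ Iv i} k (V s) := .mk (hindep s) (hspan s)
  have hb (s i) : b s i = v i.1 s := Module.Basis.mk_apply (hindep s) (hspan s) i
  have hker (r : ℝ) (htr : t ≤ r) :
      LinearMap.ker (ρ t r htr) = Submodule.span k (b t '' {i | r ∉ Iv i.1}) := by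
    refine ker_eq_span_image_of_basis (b t) (b r) _ _ (fun i hi => ⟨i.1, not_not.1 hi⟩) ?_ ?_ ?_
    · exact fun i _ j _ h => Subtype.ext (Subtype.mk.inj h)
    · intro i hi
      rw [hb, hnat _ _ _ _ i.2, hsupp _ _ hi]
    · intro i hi
      rw [hb, hb, hnat _ _ _ _ i.2]
  have hcard (S : Set {i // t ∈ Iv i}) (p : ι → Prop) (hS : ∀ i, i ∈ S ↔ p i.1) :
      Cardinal.mk S = Cardinal.mk {i // p i ∧ t ∈ Iv i} :=
    Cardinal.mk_congr <| (Equiv.subtypeEquivRight hS).trans <|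
      (Equiv.subtypeSubtypeEquivSubtypeInter (fun i => t ∈ Iv i) p).trans <|
        Equiv.subtypeEquivRight fun _ => and_comm
  constructor
  · have hKer : KerP k V ρ Lc t = Submodule.span k
        (b t '' ⋂ r : {r : ℝ // t ≤ r ∧ r ∉ Lc}, {i | r.1 ∉ Iv i.1}) := by
      simp only [KerP, hker, iInf_span_image_of_basis]
    rw [hKer, rank_span_image_of_basis]
    refine hcard _ _ fun i => ?_
    rw [lowC_subset_iff hLc]
    simp only [Set.mem_iInter, Set.mem_ofPred_eq, Subtype.forall]
    refine ⟨fun h x hx => ?_, fun h r hr hrI => hr.2 (h hrI)⟩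
    by_contra hxL
    have htx : t ≤ x := by
      by_contra! hxt
      exact hxL (hLc hxt.le ht)
    exact h x ⟨htx, hxL⟩ hx
  · have hKer : KerM k V ρ Lc t = Submodule.span k
        (b t '' ⋃ r : {r : ℝ // t ≤ r ∧ r ∈ Lc}, {i | r.1 ∉ Iv i.1}) := by
      simp only [KerM, hker, iSup_span_image]
    rw [hKer, rank_span_image_of_basis]
    refine hcard _ _ fun i => ?_
    rw [lowC_ssubset_iff (hIv i) hLc i.2]
    simp [and_assoc]
end
end

section
/- Let f : V → U be a morphism of persistence modules over ℝ and let I = ⟨a,b⟩ and J = ⟨c,d⟩ be intervals with a < c (in decorated endpoint order). Then for all t, the quotient module X_{IJ}[f](t) = Y⁺_{IJ}(t)/(Y⁻_{IJ}(t) ∩ Y⁺_{IJ}(t)) is zero. Similarly X_{IJ}[f] = 0 if b < d. Hence X_{IJ}[f] ≠ 0 implies c ≤ a < d ≤ b. -/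
/-!
Basic notions for persistence modules indexed over `ℝ`, following
Crawley-Boevey's decomposition theory.  A persistence module is given by a
family of vector spaces `V t` together with structure maps
`ρ s t : V s →ₗ[k] V t` for `s ≤ t`.  An interval of `ℝ` (possibly with
decorated endpoints) is encoded as an order-connected subset `I : Set ℝ`;
for `t ∈ I` the sets `{s | s ≤ t ∧ s ∈ I}`, `{s | s ≤ t ∧ s ∉ I}`,
`{r | t ≤ r ∧ r ∉ I}` and `{r | t ≤ r ∧ r ∈ I}` are exactly
`⟨a, t⁺⟩`, `⟨-∞, a⟩`, `⟨b, ∞⟩` and `⟨t⁻, b⟩` for `I = ⟨a, b⟩`.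
-/

open scoped Classical

noncomputable section

variable (k : Type) [Field k]

section Helpers

variable {k}
variable {V : ℝ → Type} [∀ t, AddCommGroup (V t)] [∀ t, Module k (V t)]
variable {ρ : ∀ s t : ℝ, s ≤ t → (V s →ₗ[k] V t)}
variable {U : ℝ → Type} [∀ t, AddCommGroup (U t)] [∀ t, Module k (U t)]
variable {φ : ∀ s t : ℝ, s ≤ t → (U s →ₗ[k] U t)}
variable {f : ∀ t, V t →ₗ[k] U t} {I J : Set ℝ} {t : ℝ}

lemma Xq_subsingleton_of_le (h : Yp k V ρ U φ f I J t ≤ Ym k V ρ U φ f I J t) :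
    Subsingleton (Xq k V ρ U φ f I J t) := by
  unfold Xq
  rw [Submodule.Quotient.subsingleton_iff, Submodule.comap_subtype_eq_top]
  exact h

lemma Yp_eq_bot_of_notMem_inter (h : t ∉ I ∩ J) : Yp k V ρ U φ f I J t = ⊥ := by
  by_cases hI : t ∈ I
  · have hJ : t ∉ J := fun hJ => h ⟨hI, hJ⟩
    simp [Yp, Vp, hJ]
  · simp [Yp, Vp, hI]

lemma map_ImP_le_range (hf : IsPersistenceMorphism k V ρ U φ f) {s : ℝ} (hst : s ≤ t)
    (hs : s ∈ I) : (ImP k V ρ I t).map (f t) ≤ LinearMap.range (φ s t hst) := by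
  rintro _ ⟨v, hv, rfl⟩
  obtain ⟨w, rfl⟩ := (Submodule.mem_iInf _).1 hv ⟨s, hst, hs⟩
  exact ⟨f s w, (hf s t hst w).symm⟩

lemma map_KerP_le_ker (hf : IsPersistenceMorphism k V ρ U φ f) {r : ℝ} (htr : t ≤ r)
    (hr : r ∉ I) : (KerP k V ρ I t).map (f t) ≤ LinearMap.ker (φ t r htr) := by
  rintro _ ⟨v, hv, rfl⟩
  have hv0 : ρ t r htr v = 0 := (Submodule.mem_iInf _).1 hv ⟨r, htr, hr⟩
  rw [LinearMap.mem_ker, ← hf t r htr v, hv0, map_zero]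

/-- `X_{IJ}[f](t) = 0` when `I` has a point below `t` outside `J`. -/
lemma Xq_subsingleton_of_mem_of_notMem (hf : IsPersistenceMorphism k V ρ U φ f)
    (ht : t ∈ I ∩ J) {s : ℝ} (hst : s ≤ t) (hsI : s ∈ I) (hsJ : s ∉ J) :
    Subsingleton (Xq k V ρ U φ f I J t) := by
  apply Xq_subsingleton_of_le
  have him : LinearMap.range (φ s t hst) ≤ ImM k U φ J t :=
    le_iSup (fun s : {s : ℝ // s ≤ t ∧ s ∉ J} => LinearMap.range (φ s.1 t s.2.1)) ⟨s, hst, hsJ⟩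
  simp only [Yp, Ym, Vp, Vm, if_pos ht.1, if_pos ht.2]
  refine le_trans (inf_le_inf ?_ inf_le_right) (le_sup_left.trans le_sup_right)
  exact (Submodule.map_mono inf_le_left).trans ((map_ImP_le_range hf hst hsI).trans him)

/-- `X_{IJ}[f](t) = 0` when `J` has a point above `t` outside `I`. -/
lemma Xq_subsingleton_of_notMem_of_mem (hf : IsPersistenceMorphism k V ρ U φ f)
    (ht : t ∈ I ∩ J) {r : ℝ} (htr : t ≤ r) (hrI : r ∉ I) (hrJ : r ∈ J) :
    Subsingleton (Xq k V ρ U φ f I J t) := by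
  apply Xq_subsingleton_of_le
  have hker : LinearMap.ker (φ t r htr) ≤ KerM k U φ J t :=
    le_iSup (fun r : {r : ℝ // t ≤ r ∧ r ∈ J} => LinearMap.ker (φ t r.1 r.2.1)) ⟨r, htr, hrJ⟩
  simp only [Yp, Ym, Vp, Vm, if_pos ht.1, if_pos ht.2]
  rw [inf_comm]
  refine le_trans (inf_le_inf inf_le_left ?_) (le_sup_right.trans le_sup_right)
  exact (Submodule.map_mono inf_le_right).trans ((map_KerP_le_ker hf htr hrI).trans hker)

end Helpers

/-- for intervals `I = ⟨a,b⟩` and `J = ⟨c,d⟩`, the module `X_{IJ}[f]` is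
identically zero when `a < c` (i.e. `¬ upC I ⊆ upC J`) and when `b < d` (i.e.
`¬ lowC J ⊆ lowC I`); hence `X_{IJ}[f] ≠ 0` implies `c ≤ a < d ≤ b`. -/
theorem stmt_12
    (V : ℝ → Type) [∀ t, AddCommGroup (V t)] [∀ t, Module k (V t)]
    (ρ : ∀ s t : ℝ, s ≤ t → (V s →ₗ[k] V t))
    (U : ℝ → Type) [∀ t, AddCommGroup (U t)] [∀ t, Module k (U t)]
    (φ : ∀ s t : ℝ, s ≤ t → (U s →ₗ[k] U t))
    (hV : IsPersistenceModule k V ρ) (hU : IsPersistenceModule k U φ)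
    (hVdcci : DCCImages k V ρ) (hVdcck : DCCKernels k V ρ)
    (hUdcci : DCCImages k U φ) (hUdcck : DCCKernels k U φ)
    (f : ∀ t, V t →ₗ[k] U t)
    (hf : IsPersistenceMorphism k V ρ U φ f)
    (I J : Set ℝ) (hI : I.OrdConnected) (hJ : J.OrdConnected)
    (hIne : I.Nonempty) (hJne : J.Nonempty) :
    (¬ upC I ⊆ upC J → ∀ t, Subsingleton (Xq k V ρ U φ f I J t)) ∧
    (¬ lowC J ⊆ lowC I → ∀ t, Subsingleton (Xq k V ρ U φ f I J t)) ∧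
    ((∃ t, ¬ Subsingleton (Xq k V ρ U φ f I J t)) →
      upC I ⊆ upC J ∧ lowC J ⊆ lowC I ∧ (I ∩ J).Nonempty) := by
  have hzero : ∀ t, t ∉ I ∩ J → Subsingleton (Xq k V ρ U φ f I J t) := fun t ht =>
    Xq_subsingleton_of_le ((Yp_eq_bot_of_notMem_inter ht).trans_le bot_le)
  have hlower : ¬ upC I ⊆ upC J → ∀ t, Subsingleton (Xq k V ρ U φ f I J t) := by
    intro h t
    by_cases ht : t ∈ I ∩ J
    · obtain ⟨x, ⟨s, hsI, hsx⟩, hx⟩ := Set.not_subset.1 h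
      have hxt : x < t := not_le.1 fun htx => hx ⟨t, ht.2, htx⟩
      exact Xq_subsingleton_of_mem_of_notMem hf ht (hsx.trans hxt.le) hsI
        fun hsJ => hx ⟨s, hsJ, hsx⟩
    · exact hzero t ht
  have hupper : ¬ lowC J ⊆ lowC I → ∀ t, Subsingleton (Xq k V ρ U φ f I J t) := by
    intro h t
    by_cases ht : t ∈ I ∩ J
    · obtain ⟨x, ⟨r, hrJ, hxr⟩, hx⟩ := Set.not_subset.1 h
      have htx : t < x := not_le.1 fun hxt => hx ⟨t, ht.1, hxt⟩
      exact Xq_subsingleton_of_notMem_of_mem hf ht (htx.le.trans hxr)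
        (fun hrI => hx ⟨r, hrI, hxr⟩) hrJ
    · exact hzero t ht
  refine ⟨hlower, hupper, ?_⟩
  rintro ⟨t, ht⟩
  exact ⟨not_not.1 fun h => ht (hlower h t), not_not.1 fun h => ht (hupper h t),
    t, not_not.1 fun h => ht (hzero t h)⟩
end
end

section
/- If f : k_I → k_J is a nonzero morphism of interval modules over ℝ, then the persistence module X_{IJ}[f] is isomorphic to the interval module k_{I∩J}; that is, for every t ∈ I ∩ J, X_{IJ}[f](t) ≅ k, and X_{IJ}[f](t) = 0 otherwise. -/
/-!
Basic notions for persistence modules indexed over `ℝ`, following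
Crawley-Boevey's decomposition theory.  A persistence module is given by a
family of vector spaces `V t` together with structure maps
`ρ s t : V s →ₗ[k] V t` for `s ≤ t`.  An interval of `ℝ` (possibly with
decorated endpoints) is encoded as an order-connected subset `I : Set ℝ`;
for `t ∈ I` the sets `{s | s ≤ t ∧ s ∈ I}`, `{s | s ≤ t ∧ s ∉ I}`,
`{r | t ≤ r ∧ r ∉ I}` and `{r | t ≤ r ∧ r ∈ I}` are exactly
`⟨a, t⁺⟩`, `⟨-∞, a⟩`, `⟨b, ∞⟩` and `⟨t⁻, b⟩` for `I = ⟨a, b⟩`.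
-/

open scoped Classical

noncomputable section

variable (k : Type) [Field k]

/-- At a point of `I`, all of the interval module `k_I` is `V⁺`. -/
theorem Vp_eq_top (V : ℝ → Type) [∀ t, AddCommGroup (V t)] [∀ t, Module k (V t)]
    (ρ : ∀ s t : ℝ, s ≤ t → (V s →ₗ[k] V t)) (I : Set ℝ)
    (hV0 : ∀ t ∉ I, Subsingleton (V t))
    (hVid : ∀ s t (h : s ≤ t), s ∈ I → t ∈ I → Function.Bijective (ρ s t h))
    {t : ℝ} (ht : t ∈ I) : Vp k V ρ I t = ⊤ := by
  rw [Vp, if_pos ht, inf_eq_top_iff, ImP, KerP, iInf_eq_top, iInf_eq_top]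
  refine ⟨fun s ↦ LinearMap.range_eq_top.2 (hVid _ _ s.2.1 s.2.2 ht).2, fun r ↦ ?_⟩
  have := hV0 r.1 r.2.2
  exact LinearMap.ker_eq_top.2 (Subsingleton.elim _ _)

/-- At a point of `I`, the submodule `V⁻` of the interval module `k_I` vanishes. -/
theorem Vm_eq_bot (V : ℝ → Type) [∀ t, AddCommGroup (V t)] [∀ t, Module k (V t)]
    (ρ : ∀ s t : ℝ, s ≤ t → (V s →ₗ[k] V t)) (I : Set ℝ)
    (hV0 : ∀ t ∉ I, Subsingleton (V t))
    (hVid : ∀ s t (h : s ≤ t), s ∈ I → t ∈ I → Function.Bijective (ρ s t h))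
    {t : ℝ} (ht : t ∈ I) : Vm k V ρ I t = ⊥ := by
  have hIm : ImM k V ρ I t = ⊥ := by
    rw [ImM, iSup_eq_bot]
    intro s
    have := hV0 s.1 s.2.2
    exact LinearMap.range_eq_bot.2 (Subsingleton.elim _ _)
  have hKer : KerM k V ρ I t = ⊥ := by
    rw [KerM, iSup_eq_bot]
    exact fun r ↦ LinearMap.ker_eq_bot.2 (hVid _ _ r.2.1 ht r.2.2).1
  rw [Vm, if_pos ht, hIm, hKer, bot_inf_eq, inf_bot_eq, sup_bot_eq]

/-- A nonzero morphism `k_I → k_J` is nonzero at every point of `I ∩ J`. -/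
theorem morphism_ne_zero (V : ℝ → Type) [∀ t, AddCommGroup (V t)] [∀ t, Module k (V t)]
    (ρ : ∀ s t : ℝ, s ≤ t → (V s →ₗ[k] V t))
    (U : ℝ → Type) [∀ t, AddCommGroup (U t)] [∀ t, Module k (U t)]
    (φ : ∀ s t : ℝ, s ≤ t → (U s →ₗ[k] U t)) (I J : Set ℝ)
    (hV0 : ∀ t ∉ I, Subsingleton (V t))
    (hVid : ∀ s t (h : s ≤ t), s ∈ I → t ∈ I → Function.Bijective (ρ s t h))
    (hU0 : ∀ t ∉ J, Subsingleton (U t))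
    (hUid : ∀ s t (h : s ≤ t), s ∈ J → t ∈ J → Function.Bijective (φ s t h))
    (f : ∀ t, V t →ₗ[k] U t) (hf : IsPersistenceMorphism k V ρ U φ f)
    (hfne : ∃ t x, f t x ≠ 0) {t : ℝ} (ht : t ∈ I ∩ J) : f t ≠ 0 := by
  obtain ⟨s, x, hx⟩ := hfne
  have hsI : s ∈ I := by
    by_contra h
    have := hV0 s h
    exact hx (by rw [Subsingleton.elim x 0, map_zero])
  have hsJ : s ∈ J := by
    by_contra h
    have := hU0 s h
    exact hx (Subsingleton.elim _ _)
  intro h0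
  rcases le_total s t with h | h
  · have key := hf s t h x
    rw [h0, LinearMap.zero_apply] at key
    exact hx ((map_eq_zero_iff _ (hUid s t h hsJ ht.2).1).1 key.symm)
  · obtain ⟨y, rfl⟩ := (hVid t s h ht.1 hsI).2 x
    exact hx (by rw [hf t s h y, h0, LinearMap.zero_apply, map_zero])

/-- if `f : k_I → k_J` is a nonzero morphism of interval modules, then
`X_{IJ}[f]` is isomorphic to the interval module `k_{I∩J}`: it is one-dimensional at
every `t ∈ I ∩ J` and zero elsewhere. -/
theorem stmt_13
    (V : ℝ → Type) [∀ t, AddCommGroup (V t)] [∀ t, Module k (V t)]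
    (ρ : ∀ s t : ℝ, s ≤ t → (V s →ₗ[k] V t))
    (U : ℝ → Type) [∀ t, AddCommGroup (U t)] [∀ t, Module k (U t)]
    (φ : ∀ s t : ℝ, s ≤ t → (U s →ₗ[k] U t))
    (hV : IsPersistenceModule k V ρ) (hU : IsPersistenceModule k U φ)
    (I J : Set ℝ) (hI : I.OrdConnected) (hJ : J.OrdConnected)
    (hIne : I.Nonempty) (hJne : J.Nonempty)
    -- `V` is the interval module `k_I`
    (hV0 : ∀ t ∉ I, Subsingleton (V t))
    (hV1 : ∀ t ∈ I, Nonempty (V t ≃ₗ[k] k))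
    (hVid : ∀ s t (h : s ≤ t), s ∈ I → t ∈ I → Function.Bijective (ρ s t h))
    -- `U` is the interval module `k_J`
    (hU0 : ∀ t ∉ J, Subsingleton (U t))
    (hU1 : ∀ t ∈ J, Nonempty (U t ≃ₗ[k] k))
    (hUid : ∀ s t (h : s ≤ t), s ∈ J → t ∈ J → Function.Bijective (φ s t h))
    (f : ∀ t, V t →ₗ[k] U t)
    (hf : IsPersistenceMorphism k V ρ U φ f)
    (hfne : ∃ t x, f t x ≠ 0) :
    (∀ t ∈ I ∩ J, Nonempty (Xq k V ρ U φ f I J t ≃ₗ[k] k)) ∧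
    (∀ t ∉ I ∩ J, Subsingleton (Xq k V ρ U φ f I J t)) := by
  constructor
  · intro t ht
    obtain ⟨e⟩ := hU1 t ht.2
    have hne := morphism_ne_zero k V ρ U φ I J hV0 hVid hU0 hUid f hf hfne ht
    have hsurj : Function.Surjective (f t) := by
      have hs : Function.Surjective (e.toLinearMap ∘ₗ f t) :=
        LinearMap.surjective fun h ↦ hne <| LinearMap.ext fun x ↦
          e.injective (by simpa using LinearMap.congr_fun h x)
      exact (Function.Surjective.of_comp_iff' e.bijective (f t)).1 hs
    have hp : Yp k V ρ U φ f I J t = ⊤ := by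
      rw [Yp, Vp_eq_top k V ρ I hV0 hVid ht.1, Vp_eq_top k U φ J hU0 hUid ht.2,
        Submodule.map_top, LinearMap.range_eq_top.2 hsurj, inf_top_eq]
    have hm : Ym k V ρ U φ f I J t = ⊥ := by
      rw [Ym, Vm_eq_bot k V ρ I hV0 hVid ht.1, Vm_eq_bot k U φ J hU0 hUid ht.2,
        Submodule.map_bot, sup_bot_eq]
    have hc : Submodule.comap (Yp k V ρ U φ f I J t).subtype (Ym k V ρ U φ f I J t) = ⊥ := by
      rw [hm, Submodule.comap_bot, Submodule.ker_subtype]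
    exact ⟨(Submodule.quotEquivOfEqBot _ hc).trans ((LinearEquiv.ofTop _ hp).trans e)⟩
  · intro t ht
    have hp : Yp k V ρ U φ f I J t = ⊥ := by
      by_cases hI' : t ∈ I
      · have hJ' : t ∉ J := fun h ↦ ht ⟨hI', h⟩
        rw [Yp, Vp.eq_def k U φ J, if_neg hJ', inf_bot_eq]
      · rw [Yp, Vp.eq_def k V ρ I, if_neg hI', Submodule.map_bot, bot_inf_eq]
    have : Subsingleton (Yp k V ρ U φ f I J t) := (Submodule.subsingleton_iff_eq_bot).2 hp
    exact (Submodule.mkQ_surjective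
      (Submodule.comap (Yp k V ρ U φ f I J t).subtype (Ym k V ρ U φ f I J t))).subsingleton
end
end
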